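/- Let A = kQ/I be a non simply connected toupie algebra with dim_k e_0 A e_∞ = 0. If M is an indecomposable A-module, viewed as a representation of the bound quiver (Q,I), then M_0 = 0 or M_∞ = 0, where M_x denotes the vector space of M at the vertex x. -/

import Mathlib

/-!
Formalization preamble for "Toupie algebras".

We realize the bound quiver algebra `A = kQ/I` of a toupie quiver `Q` concretely:
the path algebra `kQ` is realized, via its (faithful) left regular representation,
as the subalgebra of `Module.End k (paths → k)` generated by the operators of left
multiplication by the trivial paths `e_v` and by the arrows of `Q`.  Paths are
composed from left to right (`p * q` = "first `p`, then `q`"), as in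
Assem–Simson–Skowroński, so that paths from the source `0` to the sink `∞` span
`e₀ (kQ) e∞`, and (right) `A`-modules are identified with representations of `(Q, I)`.
Right `A`-modules are formalized as (left) modules over `Aᵐᵒᵖ`.
-/

set_option synthInstance.maxHeartbeats 400000
set_option maxHeartbeats 800000

noncomputable section
open scoped Classical
open MulOpposite

universe u

namespace Toupie

/-- Vertices of a toupie quiver with `t` branches, branch `i` having length `ℓ i ≥ 1`:
the unique source `src`, the unique sink `snk`, and for each branch `i` its interior
vertices `mid i a` (the `(a+1)`-st vertex on branch `i`, for `a : Fin (ℓ i - 1)`). -/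
inductive Vtx (t : ℕ) (ℓ : Fin t → ℕ) : Type
  | src : Vtx t ℓ
  | snk : Vtx t ℓ
  | mid (i : Fin t) (a : Fin (ℓ i - 1)) : Vtx t ℓ

/-- The `a`-th vertex on branch `i`, for `0 ≤ a ≤ ℓ i`
(`a = 0` is the source, `a = ℓ i` is the sink). -/
def vtx (t : ℕ) (ℓ : Fin t → ℕ) (i : Fin t) (a : ℕ) : Vtx t ℓ :=
  if a = 0 then .src else if h : a - 1 < ℓ i - 1 then .mid i ⟨a - 1, h⟩ else .snk

/-- The paths of a toupie quiver: trivial paths at the vertices, and for each branch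
`i` and `a < b ≤ ℓ i` the path `sub i a b` along branch `i` from its `a`-th vertex to
its `b`-th vertex.  (`sub i 0 (ℓ i)` is the `i`-th branch `w i`.) -/
inductive PIdx (t : ℕ) (ℓ : Fin t → ℕ) : Type
  | vert (v : Vtx t ℓ) : PIdx t ℓ
  | sub (i : Fin t) (a b : ℕ) (hab : a < b) (hb : b ≤ ℓ i) : PIdx t ℓ

variable (k : Type u) [Field k] (t : ℕ) (ℓ : Fin t → ℕ)

/-- The vector space with basis the set of paths of the toupie quiver. -/
abbrev PSp : Type u := PIdx t ℓ → k

variable {t ℓ}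

/-- The starting vertex of a path. -/
def startIdx : PIdx t ℓ → Vtx t ℓ
  | .vert v => v
  | .sub i a _ _ _ => vtx t ℓ i a

/-- Left multiplication by the trivial path (primitive idempotent) `e_v`. -/
def Ev (v : Vtx t ℓ) : Module.End k (PSp k t ℓ) where
  toFun f := fun p => if startIdx p = v then f p else 0
  map_add' f g := by funext p; by_cases h : startIdx p = v <;> simp [h]
  map_smul' c f := by funext p; by_cases h : startIdx p = v <;> simp [h]

/-- Strip the `j`-th arrow of branch `i` (the arrow `vtx i j ⟶ vtx i (j+1)`) from the
front of a path, if possible. -/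
def strip (i : Fin t) (j : ℕ) : PIdx t ℓ → Option (PIdx t ℓ)
  | .vert _ => none
  | .sub i' a b _ hb =>
      if h : i' = i ∧ a = j then
        if hb2 : j + 1 < b then some (.sub i (j + 1) b hb2 (h.1 ▸ hb))
        else some (.vert (vtx t ℓ i b))
      else none

/-- Left multiplication by the `j`-th arrow of branch `i`
(the arrow from `vtx i j` to `vtx i (j+1)`, for `j < ℓ i`; the zero operator for junk `j`). -/
def Ar (i : Fin t) (j : ℕ) : Module.End k (PSp k t ℓ) where
  toFun f := fun p => (strip i j p).elim 0 f
  map_add' f g := by funext p; rcases h : strip i j p with _ | q <;> simp [h]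
  map_smul' c f := by funext p; rcases h : strip i j p with _ | q <;> simp [h]

variable (t ℓ)

/-- The generators of the path algebra: the trivial paths and the arrows. -/
def gens : Set (Module.End k (PSp k t ℓ)) :=
  Set.range (Ev k) ∪ {x | ∃ i j, x = Ar k i j}

/-- The path algebra `kQ` of the toupie quiver, realized as the subalgebra of
`Module.End k (PSp k t ℓ)` generated by left multiplication by trivial paths and arrows. -/
def PathAlg : Subalgebra k (Module.End k (PSp k t ℓ)) :=
  Algebra.adjoin k (gens k t ℓ)

variable {k t ℓ}

/-- The trivial path `e_v` as an element of the path algebra. -/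
def eV (v : Vtx t ℓ) : PathAlg k t ℓ :=
  ⟨Ev k v, Algebra.subset_adjoin (Or.inl ⟨v, rfl⟩)⟩

/-- The `j`-th arrow of branch `i` as an element of the path algebra. -/
def arE (i : Fin t) (j : ℕ) : PathAlg k t ℓ :=
  ⟨Ar k i j, Algebra.subset_adjoin (Or.inr ⟨i, j, rfl⟩)⟩

/-- The path along branch `i` from its `a`-th vertex to its `b`-th vertex, as an element
of the path algebra: the product (composed from left to right) of the arrows
`a → a+1 → ⋯ → b`.  (For `b ≤ a` this is the empty product `1`.) -/
def subE (i : Fin t) (a b : ℕ) : PathAlg k t ℓ :=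
  (((List.range (b - a)).map fun s => arE i (a + s)).prod)

/-- The `i`-th branch `w i` (the path from the source to the sink along branch `i`)
as an element of the path algebra. -/
def wE (i : Fin t) : PathAlg k t ℓ := subE i 0 (ℓ i)

variable {k : Type u} [Field k]

/-- A toupie algebra `A = kQ/I`: a toupie quiver `Q` (a non-linear quiver with a unique
source, a unique sink, and all other vertices having exactly one incoming and one
outgoing arrow, i.e. `t ≥ 2` branches of lengths `ℓ i ≥ 1`), together with an admissible
ideal `I` of the path algebra `kQ`.  Since `Q` is finite and acyclic, the arrow ideal is
nilpotent, so admissibility amounts to `I ⊆ R_Q²`, i.e. every element of `I` is a linear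
combination of paths of length `≥ 2`. -/
structure ToupieAlg (k : Type u) [Field k] : Type u where
  t : ℕ
  ht : 2 ≤ t
  ℓ : Fin t → ℕ
  hℓ : ∀ i, 1 ≤ ℓ i
  I : TwoSidedIdeal (PathAlg k t ℓ)
  adm : ∀ x ∈ I, x ∈ Submodule.span k
    {y : PathAlg k t ℓ | ∃ i a b, a + 2 ≤ b ∧ b ≤ ℓ i ∧ y = subE i a b}

variable (T : ToupieAlg k)

/-- The underlying algebra `A = kQ/I` of a toupie algebra. -/
def Alg : Type u := T.I.ringCon.Quotient

instance : Ring (Alg T) := inferInstanceAs (Ring T.I.ringCon.Quotient)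

/-- The quotient map `kQ → A = kQ/I`. -/
def mkA : PathAlg k T.t T.ℓ →+* Alg T := T.I.ringCon.mk'

lemma mkA_surjective : Function.Surjective (mkA T) := Quotient.mk''_surjective

instance : Algebra k (Alg T) :=
  RingHom.toAlgebra' ((mkA T).comp (algebraMap k (PathAlg k T.t T.ℓ)))
    (by
      intro c x
      obtain ⟨y, rfl⟩ := mkA_surjective T x
      simp only [RingHom.coe_comp, Function.comp_apply, ← map_mul]
      rw [Algebra.commutes])

/-- The idempotent `e₀` (at the source) in `A`. -/
def e0 : Alg T := mkA T (eV Vtx.src)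

/-- The idempotent `e∞` (at the sink) in `A`. -/
def einf : Alg T := mkA T (eV Vtx.snk)

/-- The `k`-linear map `A → A`, `x ↦ e₀ * x * e∞`, whose range is `e₀ A e∞`. -/
def lrMap : Alg T →ₗ[k] Alg T where
  toFun x := e0 T * x * einf T
  map_add' x y := by simp [mul_add, add_mul]
  map_smul' c x := by
    simp only [RingHom.id_apply]
    rw [mul_smul_comm, smul_mul_assoc]

/-- `m = dim_k e₀ A e∞`, the dimension of the span of the (residues of the) paths from
the source to the sink. -/
def mDim : ℕ := Module.finrank k ↥(LinearMap.range (lrMap T))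

/-- The branch `w i` lies in the ideal `I`. -/
def branchInI (i : Fin T.t) : Prop := wE i ∈ T.I

/-- A minimal relation: `∑_{i ∈ J} λ i • w i ∈ I` with `|J| ≥ 2`, all `λ i ≠ 0`, and no
nonempty proper subsum in `I`. -/
def MinRel (J : Finset (Fin T.t)) (lam : Fin T.t → k) : Prop :=
  2 ≤ J.card ∧ (∀ i ∈ J, lam i ≠ 0) ∧ (∑ i ∈ J, lam i • wE i) ∈ T.I ∧
    ∀ J' ⊂ J, J'.Nonempty → (∑ i ∈ J', lam i • wE i) ∉ T.I

/-- A toupie algebra is simply connected if any two distinct branches are involved in a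
common minimal relation. -/
def SimplyConnected : Prop :=
  ∀ i j : Fin T.t, i ≠ j → ∃ J lam, MinRel T J lam ∧ i ∈ J ∧ j ∈ J

/-- A (minimal) zero-relation on branch `i`: the subpath of branch `i` from its `a`-th
to its `b`-th vertex lies in `I`, but no proper subpath of it does. -/
def ZeroRel (i : Fin T.t) (a b : ℕ) : Prop :=
  a < b ∧ b ≤ T.ℓ i ∧ subE i a b ∈ T.I ∧
    ∀ a' b', a ≤ a' → b' ≤ b → a' < b' → (a', b') ≠ (a, b) → subE i a' b' ∉ T.I

/-- There is exactly one relation on branch `i`. -/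
def ExactlyOneRel (i : Fin T.t) : Prop := ∃! p : ℕ × ℕ, ZeroRel T i p.1 p.2

/-- Branch `i` carries more than one relation. -/
def MoreThanOneRel (i : Fin T.t) : Prop :=
  ∃ p q : ℕ × ℕ, p ≠ q ∧ ZeroRel T i p.1 p.2 ∧ ZeroRel T i q.1 q.2

/-- At most one branch of `Q` has length at least three. -/
def AtMostOneLongBranch : Prop := ∀ i j : Fin T.t, 3 ≤ T.ℓ i → 3 ≤ T.ℓ j → i = j

/-- The two-sided ideal `I` is generated by the set `S`. -/
def IsGenBy {R : Type u} [Ring R] (I : TwoSidedIdeal R) (S : Set R) : Prop :=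
  S ⊆ (I : Set R) ∧ ∀ J : TwoSidedIdeal R, S ⊆ (J : Set R) → (I : Set R) ⊆ (J : Set R)

/-- A toupie algebra is canonical if (after choosing two distinguished branches `i₁, i₂`)
its ideal is generated by `{w i₁ + λ j • w i₂ - w j}` over the remaining branches `j`,
with the `λ j` pairwise distinct and nonzero. -/
def IsCanonical : Prop :=
  ∃ (i₁ i₂ : Fin T.t) (lam : Fin T.t → k), i₁ ≠ i₂ ∧
    (∀ j, j ≠ i₁ → j ≠ i₂ → lam j ≠ 0) ∧
    (∀ j j', j ≠ i₁ → j ≠ i₂ → j' ≠ i₁ → j' ≠ i₂ → j ≠ j' → lam j ≠ lam j') ∧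
    IsGenBy T.I {x | ∃ j, j ≠ i₁ ∧ j ≠ i₂ ∧ x = wE i₁ + lam j • wE i₂ - wE j}

end Toupie
namespace Toupie

/-! ### Module-theoretic notions over an arbitrary ring

Following the paper, all modules are finite-dimensional *right* modules; a right
`A`-module is formalized as a (left) module over `Aᵐᵒᵖ`.  The definitions below are
stated for modules over an arbitrary ring `R` and are applied with `R := Aᵐᵒᵖ`. -/

variable (R : Type u) [Ring R]

/-- A module is indecomposable if it is nonzero and its only idempotent endomorphisms
are `0` and the identity. -/
def Indec (M : ModuleCat.{u} R) : Prop :=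
  Nontrivial M ∧ ∀ f : M →ₗ[R] M, f.comp f = f → f = 0 ∨ f = LinearMap.id

/-- Finiteness ("finite dimensionality") of a module. -/
def FdMod (M : ModuleCat.{u} R) : Prop := Module.Finite R M

/-- `M` has projective dimension at most one: it is the quotient of a projective module
by a projective submodule. -/
def PdLeOne (M : ModuleCat.{u} R) : Prop :=
  ∃ (P : ModuleCat.{u} R) (f : P →ₗ[R] M), Function.Surjective f ∧
    Module.Projective R P ∧ Module.Projective R ↥(LinearMap.ker f)

/-- `M` has injective dimension at most one: it embeds in an injective module with
injective cokernel. -/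
def IdLeOne (M : ModuleCat.{u} R) : Prop :=
  ∃ (E : ModuleCat.{u} R) (f : M →ₗ[R] E), Function.Injective f ∧
    Module.Injective R E ∧ Module.Injective R (E ⧸ LinearMap.range f)

/-- One step of a path in `ind R`: a nonzero non-isomorphism between (finite-dimensional)
indecomposable modules. -/
def Step (M N : ModuleCat.{u} R) : Prop :=
  Indec R M ∧ FdMod R M ∧ Indec R N ∧ FdMod R N ∧
    ∃ f : M →ₗ[R] N, f ≠ 0 ∧ ¬ Function.Bijective f

/-- A path in `ind R` from `M` to `N` (possibly trivial): a chain
`M = M₀ → M₁ → ⋯ → Mₙ = N` of nonzero non-isomorphisms between indecomposables. -/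
def IndPath (M N : ModuleCat.{u} R) : Prop := Relation.ReflTransGen (Step R) M N

/-- The left part `L_R`: the indecomposable (finite-dimensional) modules `M` such that
every indecomposable `X` with a path `X ⇝ M` in `ind R` has projective dimension `≤ 1`. -/
def InLeftPart (M : ModuleCat.{u} R) : Prop :=
  Indec R M ∧ FdMod R M ∧
    ∀ X : ModuleCat.{u} R, Indec R X → FdMod R X → IndPath R X M → PdLeOne R X

/-- The right part `R_R`: the indecomposable (finite-dimensional) modules `M` such that
every indecomposable `X` with a path `M ⇝ X` in `ind R` has injective dimension `≤ 1`. -/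
def InRightPart (M : ModuleCat.{u} R) : Prop :=
  Indec R M ∧ FdMod R M ∧
    ∀ X : ModuleCat.{u} R, Indec R X → FdMod R X → IndPath R M X → IdLeOne R X

/-- Hereditary: global dimension at most one, i.e. every module has projective dimension
at most one. -/
def Hereditary : Prop := ∀ M : ModuleCat.{u} R, PdLeOne R M

/-- Quasitilted: every indecomposable projective module lies in the left part. -/
def Quasitilted : Prop :=
  ∀ P : ModuleCat.{u} R, Indec R P → FdMod R P → Module.Projective R P → InLeftPart R P

/-- A module is directed if it lies on no cycle of nonzero non-isomorphisms between
indecomposables in `ind R`. -/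
def Directed (M : ModuleCat.{u} R) : Prop := ¬ Relation.TransGen (Step R) M M

/-- Weakly shod: every indecomposable (finite-dimensional) module not lying in
`L_R ∪ R_R` is directed. -/
def WeaklyShod : Prop :=
  ∀ M : ModuleCat.{u} R, Indec R M → FdMod R M →
    ¬ InLeftPart R M → ¬ InRightPart R M → Directed R M

/-- Laura: all but finitely many isomorphism classes of indecomposable
(finite-dimensional) modules lie in `L_R ∪ R_R`. -/
def Laura : Prop :=
  ∃ S : Set (ModuleCat.{u} R), S.Finite ∧
    ∀ M : ModuleCat.{u} R, Indec R M → FdMod R M →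
      ¬ InLeftPart R M → ¬ InRightPart R M → ∃ N ∈ S, Nonempty (M ≃ₗ[R] N)

/-- There are exactly `n` isomorphism classes of modules satisfying `P`. -/
def NumClasses (P : ModuleCat.{u} R → Prop) (n : ℕ) : Prop :=
  ∃ f : Fin n → ModuleCat.{u} R, (∀ i, P (f i)) ∧
    (∀ i j, Nonempty ((f i : Type u) ≃ₗ[R] (f j : Type u)) → i = j) ∧
    ∀ M : ModuleCat.{u} R, P M → ∃ i, Nonempty ((M : Type u) ≃ₗ[R] (f i : Type u))

/-- `M` is (isomorphic to) a direct summand of `T`. -/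
def IsSummandOf (T : Type u) [AddCommGroup T] [Module R T] (M : ModuleCat.{u} R) : Prop :=
  ∃ N N' : Submodule R T, IsCompl N N' ∧ Nonempty ((M : Type u) ≃ₗ[R] N)

/-- `Ext¹_R(T, T) = 0`: every self-extension `0 → T → E → T → 0` splits. -/
def SelfExtVanish (T : Type u) [AddCommGroup T] [Module R T] : Prop :=
  ∀ (E : Type u) [AddCommGroup E] [Module R E] (ι : T →ₗ[R] E) (π : E →ₗ[R] T),
    Function.Injective ι → Function.Surjective π → LinearMap.range ι = LinearMap.ker π →
      ∃ s : T →ₗ[R] E, π.comp s = LinearMap.id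

/-- A tilting module over a hereditary algebra: a finite module with `Ext¹(T,T) = 0`
having as many pairwise non-isomorphic indecomposable direct summands as there are
simple modules. -/
def IsTiltingMod (T : Type u) [AddCommGroup T] [Module R T] : Prop :=
  Module.Finite R T ∧ SelfExtVanish R T ∧
    ∃ n : ℕ, NumClasses R (fun M => Indec R M ∧ IsSummandOf R T M) n ∧
      NumClasses R (fun M => IsSimpleModule R M) n

variable (k : Type u) [Field k]

/-- A `k`-algebra `A` is tilted if it is the endomorphism algebra of a tilting (right)
module over a hereditary finite-dimensional `k`-algebra `H`.  (Right `H`-modules are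
modules over `Hᵐᵒᵖ`; the isomorphism `A ≅ End_H T` is a `k`-linear ring isomorphism.) -/
def IsTilted (A : Type u) [Ring A] [Algebra k A] : Prop :=
  ∃ (H : Type u) (_ : Ring H) (_ : Algebra k H),
    FiniteDimensional k H ∧ Hereditary Hᵐᵒᵖ ∧
      ∃ (T : Type u) (_ : AddCommGroup T) (_ : Module Hᵐᵒᵖ T),
        IsTiltingMod Hᵐᵒᵖ T ∧
          ∃ (_ : Module k T) (_ : SMulCommClass Hᵐᵒᵖ k T) (_ : IsScalarTower k Hᵐᵒᵖ T)
            (φ : A ≃+* Module.End Hᵐᵒᵖ T), ∀ (c : k) (x : A), φ (c • x) = c • φ x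

end Toupie
namespace Toupie

variable {k : Type u} [Field k] (T : ToupieAlg k)

/-! ### Right `A`-modules as representations of `(Q, I)`

For a right `A`-module `M` (a module over `Aᵐᵒᵖ`) and a vertex `v`, the space of the
corresponding representation at `v` is `M_v = M • e_v`. -/

/-- The action of the idempotent `e_v ∈ A` on a right `A`-module (= `Aᵐᵒᵖ`-module). -/
def actV (v : Vtx T.t T.ℓ) : (Alg T)ᵐᵒᵖ := op (mkA T (eV v))

/-- The space `M_v = M • e_v` of the representation `M` at the vertex `v` is zero. -/
def VanishAt (M : ModuleCat.{u} (Alg T)ᵐᵒᵖ) (v : Vtx T.t T.ℓ) : Prop :=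
  ∀ m : M, actV T v • m = 0

/-- Every simple summand of `top M = M / rad M` is one of the simple modules `S_v`,
`v ∈ vs`: for every maximal submodule `N` the simple quotient `M/N` is supported at some
vertex of `vs` (for an admissible quotient of a path algebra, the simple module `S_v` is
the unique simple on which `e_v` acts nontrivially). -/
def TopIn (M : ModuleCat.{u} (Alg T)ᵐᵒᵖ) (vs : Set (Vtx T.t T.ℓ)) : Prop :=
  ∀ N : Submodule (Alg T)ᵐᵒᵖ M, IsCoatom N → ∃ v ∈ vs, ∃ m : M, actV T v • m ∉ N

/-- Every simple summand of the socle of `M` is one of the simple modules `S_v`,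
`v ∈ vs`: every simple submodule `N ≤ M` is supported at some vertex of `vs`. -/
def SocIn (M : ModuleCat.{u} (Alg T)ᵐᵒᵖ) (vs : Set (Vtx T.t T.ℓ)) : Prop :=
  ∀ N : Submodule (Alg T)ᵐᵒᵖ M, IsAtom N → ∃ v ∈ vs, ∃ m ∈ N, actV T v • m ≠ 0

/-- The module `D x y` (for two positions `0 ≤ x, y ≤ ℓ i₀` on the unique branch `i₀`
lying in `I`, and an auxiliary branch `i₂ ≠ i₀`): the right `A`-module with generators
`g = e₀` (at the source) and `h = e_y` (at the `y`-th vertex of branch `i₀`), subject to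
the relations `g ⬝ (subpath of w i₀ from 0 to x+1) = 0` and
`g ⬝ w i₂ = h ⬝ (subpath of w i₀ from y to ℓ i₀)`.  It is presented as the quotient of
the right regular module `A ⊕ A` by the right submodule generated by
`(1 - e₀, 0)`, `(0, 1 - e_y)`, `(subE i₀ 0 (min (x+1) (ℓ i₀)), 0)` and
`(w i₂, - subE i₀ y (ℓ i₀))`. -/
abbrev Dmod (i₀ i₂ : Fin T.t) (x y : ℕ) : Type u :=
  (Alg T × Alg T) ⧸ Submodule.span (Alg T)ᵐᵒᵖ
    ({((mkA T (1 - eV Vtx.src) : Alg T), (0 : Alg T)),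
      ((0 : Alg T), (mkA T (1 - eV (vtx T.t T.ℓ i₀ y)) : Alg T)),
      ((mkA T (subE i₀ 0 (min (x + 1) (T.ℓ i₀))) : Alg T), (0 : Alg T)),
      ((mkA T (wE i₂) : Alg T), (- mkA T (subE i₀ y (T.ℓ i₀)) : Alg T))} :
        Set (Alg T × Alg T))

end Toupie

namespace Toupie

section LinearAlgebra

variable {k M : Type*} [Field k] [AddCommGroup M] [Module k M]

/-- A projection onto `V.map f` lifts along `f` to a projection onto `V`. -/
lemma exists_projection_lift (f d : M →ₗ[k] M) (V : Submodule k M)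
    (hd : ∀ x, d x ∈ V.map f) (hd' : ∀ x ∈ V.map f, d x = x) :
    ∃ δ : M →ₗ[k] M, (∀ x, δ x ∈ V) ∧ (∀ x ∈ V, δ x = x) ∧ ∀ x, d (f x) = f (δ x) := by
  obtain ⟨p, hp⟩ := LinearMap.exists_leftInverse_of_injective V.subtype (by simp)
  obtain ⟨s, hs⟩ := LinearMap.exists_rightInverse_of_surjective (f.submoduleMap V)
    (LinearMap.range_eq_top.2 (f.submoduleMap_surjective V))
  have hpV : ∀ x (hx : x ∈ V), (p x : M) = x := fun x hx =>
    congrArg Subtype.val (LinearMap.congr_fun hp ⟨x, hx⟩)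
  have hfs : ∀ y, f (s y) = y := fun y => congrArg Subtype.val (LinearMap.congr_fun hs y)
  let q : M →ₗ[k] M := LinearMap.id - V.subtype ∘ₗ p
  refine ⟨V.subtype ∘ₗ (p + s ∘ₗ (d.codRestrict _ hd) ∘ₗ f ∘ₗ q), fun x => ?_, fun x hx => ?_,
    fun x => ?_⟩
  · exact Subtype.property ((p + s ∘ₗ (d.codRestrict _ hd) ∘ₗ f ∘ₗ q) x)
  · have hq : q x = 0 := by simp [q, hpV x hx]
    have h : (p + s ∘ₗ (d.codRestrict _ hd) ∘ₗ f ∘ₗ q) x = p x := by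
      rw [LinearMap.add_apply]
      simp only [LinearMap.comp_apply, hq, map_zero, add_zero]
    exact (congrArg Subtype.val h).trans (hpV x hx)
  · have h1 : d (f (p x)) = f (p x) := hd' _ (Submodule.mem_map_of_mem (p x).2)
    simp [hfs, q, h1]

/-- Along a chain of maps, the successive images of a subspace which eventually vanish
admit a compatible family of projections. -/
lemma exists_projection_chain (n : ℕ) (f : ℕ → M →ₗ[k] M) (W : ℕ → Submodule k M)
    (hW : ∀ a, W (a + 1) = (W a).map (f a)) (hn : W n = ⊥) :
    ∃ δ : ℕ → M →ₗ[k] M, (∀ a ≤ n, (∀ x, δ a x ∈ W a) ∧ ∀ x ∈ W a, δ a x = x) ∧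
      ∀ a < n, ∀ x, δ (a + 1) (f a x) = f a (δ a x) := by
  induction n generalizing f W with
  | zero =>
    refine ⟨0, fun a ha => ?_, by simp⟩
    obtain rfl : a = 0 := by lia
    simp +contextual [hn]
  | succ n ih =>
    obtain ⟨δ, h1, h2⟩ := ih (fun a => f (a + 1)) (fun a => W (a + 1)) (fun a => hW _) hn
    obtain ⟨d, e1, e2, e3⟩ := exists_projection_lift (f 0) (δ 0) (W 0)
      (fun x => hW 0 ▸ (h1 0 (by simp)).1 x) (fun x hx => (h1 0 (by simp)).2 x (hW 0 ▸ hx))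
    refine ⟨fun a => Nat.casesOn a d δ, fun a ha => ?_, fun a ha => ?_⟩
    · cases a with
      | zero => exact ⟨e1, e2⟩
      | succ a => exact h1 a (by lia)
    · cases a with
      | zero => exact e3
      | succ a => exact h2 a (by lia)

end LinearAlgebra

section PathAlgebra

variable {k : Type u} [Field k] {t : ℕ} {ℓ : Fin t → ℕ}

instance : Finite (Vtx t ℓ) :=
  Finite.of_surjective
    (fun x : Option (Option (Σ i : Fin t, Fin (ℓ i - 1))) =>
      match x with
      | none => Vtx.src
      | some none => Vtx.snk
      | some (some ⟨i, a⟩) => Vtx.mid i a)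
    (by
      rintro (_ | _ | ⟨i, a⟩)
      exacts [⟨none, rfl⟩, ⟨some none, rfl⟩, ⟨some (some ⟨i, a⟩), rfl⟩])

instance : Fintype (Vtx t ℓ) := Fintype.ofFinite _

instance : Finite (PIdx t ℓ) :=
  Finite.of_injective
    (fun p : PIdx t ℓ =>
      (match p with
      | .vert v => Sum.inl v
      | .sub i a b hab hb => Sum.inr ⟨i, ⟨a, by lia⟩, ⟨b, by lia⟩⟩ :
        Vtx t ℓ ⊕ (Σ i : Fin t, Fin (ℓ i + 1) × Fin (ℓ i + 1))))
    (by
      rintro (v | ⟨i, a, b, hab, hb⟩) (w | ⟨i', a', b', hab', hb'⟩) h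
      · simpa using h
      · simp at h
      · simp at h
      · simp only [Sum.inr.injEq, Sigma.mk.injEq] at h
        obtain ⟨rfl, h⟩ := h
        simpa using h)

lemma vtx_zero (i : Fin t) : vtx t ℓ i 0 = .src := by simp [vtx]

lemma vtx_length {i : Fin t} (hi : 1 ≤ ℓ i) : vtx t ℓ i (ℓ i) = .snk := by
  simp [vtx]; lia

lemma vtx_mid (i : Fin t) (a : Fin (ℓ i - 1)) : vtx t ℓ i (a + 1) = .mid i a := by
  simp [vtx]

lemma eV_mul_eV (v w : Vtx t ℓ) : (eV v * eV w : PathAlg k t ℓ) = if v = w then eV v else 0 := by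
  split_ifs with h
  · subst h
    ext f p
    by_cases hp : startIdx p = v <;> simp [eV, Ev, hp]
  · ext f p
    by_cases hp : startIdx p = v
    · simp [eV, Ev, hp, h]
    · simp [eV, Ev, hp]

lemma arE_eq_zero {i : Fin t} {j : ℕ} (hj : ℓ i ≤ j) : (arE i j : PathAlg k t ℓ) = 0 := by
  ext f p
  have h : strip i j p = none := by
    rcases p with v | ⟨i', a, b, hab, hb⟩
    · rfl
    · simp only [strip]
      rw [dif_neg]
      rintro ⟨rfl, rfl⟩
      lia
  simp [arE, Ar, h]

lemma eV_mul_arE (i : Fin t) (j : ℕ) :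
    (eV (vtx t ℓ i j) * arE i j : PathAlg k t ℓ) = arE i j := by
  ext f p
  by_cases h : startIdx p = vtx t ℓ i j
  · simp [arE, Ar, eV, Ev, h]
  · have h' : strip i j p = none := by
      rcases p with v | ⟨i', a, b, hab, hb⟩
      · rfl
      · simp only [strip]
        rw [dif_neg]
        rintro ⟨rfl, rfl⟩
        exact h rfl
    simp [arE, Ar, eV, Ev, h']

lemma arE_mul_eV (i : Fin t) (j : ℕ) :
    (arE i j * eV (vtx t ℓ i (j + 1)) : PathAlg k t ℓ) = arE i j := by
  ext f p
  have h : ∀ q, strip i j p = some q → startIdx q = vtx t ℓ i (j + 1) := by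
    intro q hq
    rcases p with v | ⟨i', a, b, hab, hb⟩
    · simp [strip] at hq
    · simp only [strip] at hq
      split_ifs at hq with h1 h2
      · obtain rfl := Option.some.inj hq
        rfl
      · obtain rfl := Option.some.inj hq
        obtain rfl : b = j + 1 := by lia
        rfl
  rcases hs : strip i j p with _ | q
  · simp [arE, Ar, eV, Ev, hs]
  · simp [arE, Ar, eV, Ev, hs, h q hs]

lemma subE_succ (i : Fin t) (n : ℕ) :
    (subE i 0 (n + 1) : PathAlg k t ℓ) = subE i 0 n * arE i n := by
  simp [subE, List.range_succ]

lemma wE_mul_eV {i : Fin t} (hi : 1 ≤ ℓ i) :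
    (wE i * eV .snk : PathAlg k t ℓ) = wE i := by
  obtain ⟨n, hn⟩ := Nat.exists_eq_add_of_le' hi
  rw [wE, ← vtx_length hi, hn, subE_succ, mul_assoc, arE_mul_eV]

/-- A property of elements of the path algebra that holds for scalars, trivial paths and
arrows and is stable under sums and products holds everywhere. -/
lemma PathAlg.induction {P : PathAlg k t ℓ → Prop} (hs : ∀ c, P (algebraMap k _ c))
    (he : ∀ v, P (eV v)) (ha : ∀ i j, P (arE i j)) (hadd : ∀ x y, P x → P y → P (x + y))
    (hmul : ∀ x y, P x → P y → P (x * y)) (x : PathAlg k t ℓ) : P x := by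
  obtain ⟨x, hx⟩ := x
  induction hx using Algebra.adjoin_induction with
  | mem x hx =>
    rcases hx with ⟨v, rfl⟩ | ⟨i, j, rfl⟩
    exacts [he v, ha i j]
  | algebraMap c => exact hs c
  | add x y _ _ hx hy => exact hadd _ _ hx hy
  | mul x y _ _ hx hy => exact hmul _ _ hx hy

end PathAlgebra

section Modules

variable {k : Type u} [Field k] (T : ToupieAlg k)

lemma mkA_algebraMap (c : k) : mkA T (algebraMap k _ c) = algebraMap k (Alg T) c := rfl

instance : Module.Finite k (Alg T) := by
  have : Module.Finite k (PathAlg k T.t T.ℓ) :=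
    inferInstanceAs (Module.Finite k (Subalgebra.toSubmodule (PathAlg k T.t T.ℓ)))
  let f : PathAlg k T.t T.ℓ →ₗ[k] Alg T :=
    { toFun := mkA T
      map_add' := map_add _
      map_smul' := fun c x => by
        rw [Algebra.smul_def, map_mul, mkA_algebraMap, RingHom.id_apply, Algebra.smul_def] }
  exact Module.Finite.of_surjective f (mkA_surjective T)

variable {T}

lemma e0_mul_mul_einf (hm : mDim T = 0) (x : Alg T) : e0 T * x * einf T = 0 := by
  have h : LinearMap.range (lrMap T) = ⊥ := Submodule.finrank_eq_zero.1 hm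
  exact LinearMap.congr_fun (LinearMap.range_eq_bot.1 h) x

lemma mkA_src_mul_wE (hm : mDim T = 0) (i : Fin T.t) : mkA T (eV .src * wE i) = 0 := by
  rw [← wE_mul_eV (T.hℓ i), ← mul_assoc, map_mul, map_mul]
  exact e0_mul_mul_einf hm _

variable {M : Type*} [AddCommGroup M] [Module (Alg T)ᵐᵒᵖ M] [Module k M]
  [IsScalarTower k (Alg T)ᵐᵒᵖ M]

variable (T M) in
/-- The right action of an element of the path algebra on an `A`-module. -/
def act (x : PathAlg k T.t T.ℓ) : M →ₗ[k] M := Algebra.lsmul k k M (op (mkA T x))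

lemma act_apply (x : PathAlg k T.t T.ℓ) (m : M) : act T M x m = op (mkA T x) • m := rfl

lemma act_mul (x y : PathAlg k T.t T.ℓ) (m : M) :
    act T M (x * y) m = act T M y (act T M x m) := by
  simp [act_apply, mul_smul]

lemma act_eV_eV (v w : Vtx T.t T.ℓ) (m : M) :
    act T M (eV w) (act T M (eV v) m) = if v = w then act T M (eV v) m else 0 := by
  rw [← act_mul, eV_mul_eV]
  split_ifs <;> simp [act_apply]

lemma act_arE_eV (i : Fin T.t) (j : ℕ) (m : M) :
    act T M (eV (vtx T.t T.ℓ i (j + 1))) (act T M (arE i j) m) = act T M (arE i j) m := by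
  rw [← act_mul, arE_mul_eV]

lemma act_eV_arE (i : Fin T.t) (j : ℕ) (m : M) :
    act T M (arE i j) (act T M (eV (vtx T.t T.ℓ i j)) m) = act T M (arE i j) m := by
  rw [← act_mul, eV_mul_arE]

/-- Along each branch, the subrepresentation generated by the space at the source admits
a compatible family of projections, if the branch acts by zero. -/
lemma exists_branch_projection (hm : mDim T = 0) (i : Fin T.t) :
    ∃ δ : ℕ → M →ₗ[k] M,
      (∀ m, δ 0 (act T M (eV .src) m) = act T M (eV .src) m) ∧
      (∀ m, δ (T.ℓ i) m = 0) ∧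
      (∀ a ≤ T.ℓ i, ∀ m, δ a (δ a m) = δ a m) ∧
      (∀ a ≤ T.ℓ i, ∀ m, act T M (eV (vtx T.t T.ℓ i a)) (δ a m) = δ a m) ∧
      ∀ a < T.ℓ i, ∀ m, δ (a + 1) (act T M (arE i a) m) = act T M (arE i a) (δ a m) := by
  let W : ℕ → Submodule k M := fun a => LinearMap.range (act T M (eV .src * subE i 0 a))
  have hW : ∀ a, W (a + 1) = (W a).map (act T M (arE i a)) := fun a => by
    simp only [W]
    rw [← LinearMap.range_comp, subE_succ, ← mul_assoc]
    exact congrArg LinearMap.range (LinearMap.ext fun m => act_mul _ _ m)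
  have hn : W (T.ℓ i) = ⊥ := LinearMap.range_eq_bot.2 (by
    ext m
    rw [act_apply, ← wE, mkA_src_mul_wE hm]
    simp)
  have hsupp : ∀ a, ∀ x ∈ W a, act T M (eV (vtx T.t T.ℓ i a)) x = x := by
    rintro (_ | a) x hx
    · obtain ⟨m, rfl⟩ := hx
      simp [subE, vtx_zero, act_eV_eV]
    · rw [hW] at hx
      obtain ⟨y, -, rfl⟩ := hx
      exact act_arE_eV i a y
  obtain ⟨δ, h1, h2⟩ := exists_projection_chain (T.ℓ i) (fun a => act T M (arE i a)) W hW hn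
  refine ⟨δ, fun m => (h1 0 (by simp)).2 _ ⟨m, by simp [subE]⟩, fun m => ?_,
    fun a ha m => (h1 a ha).2 _ ((h1 a ha).1 m), fun a ha m => hsupp a _ ((h1 a ha).1 m), h2⟩
  have h := (h1 _ le_rfl).1 m
  rwa [hn, Submodule.mem_bot] at h

/-- If all branches vanish in `A`, then there is an idempotent endomorphism of `M` which is
the identity at the source and zero at the sink. -/
lemma exists_idempotent (hm : mDim T = 0) :
    ∃ φ : M →ₗ[(Alg T)ᵐᵒᵖ] M, φ.comp φ = φ ∧
      (∀ m, φ (act T M (eV .src) m) = act T M (eV .src) m) ∧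
      ∀ m, φ (act T M (eV .snk) m) = 0 := by
  choose δ hsrc hsnk hid hsupp hcomm using fun i => exists_branch_projection (M := M) hm i
  let ψ : Vtx T.t T.ℓ → M →ₗ[k] M := fun v =>
    match v with
    | .src => LinearMap.id
    | .snk => 0
    | .mid i a => δ i (a + 1)
  have hψδ : ∀ i, ∀ a ≤ T.ℓ i, ∀ m, ψ (vtx T.t T.ℓ i a) (act T M (eV (vtx T.t T.ℓ i a)) m) =
      δ i a (act T M (eV (vtx T.t T.ℓ i a)) m) := by
    intro i a ha m
    rcases Nat.eq_zero_or_pos a with rfl | hpos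
    · rw [vtx_zero, hsrc]
      rfl
    · rcases ha.eq_or_lt with rfl | hlt
      · rw [vtx_length (T.hℓ i), hsnk]
        rfl
      · obtain ⟨b, rfl⟩ := Nat.exists_eq_add_of_le' hpos
        rw [show vtx T.t T.ℓ i (b + 1) = .mid i ⟨b, by lia⟩ from vtx_mid i ⟨b, by lia⟩]
  have hψE : ∀ v m, act T M (eV v) (ψ v (act T M (eV v) m)) = ψ v (act T M (eV v) m) := by
    rintro (_ | _ | ⟨i, a⟩) m
    · simp [ψ, act_eV_eV]
    · simp [ψ]
    · have h := hsupp i (a + 1) (by lia) (act T M (eV (.mid i a)) m)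
      rwa [vtx_mid] at h
  have hψψ : ∀ v m, ψ v (ψ v m) = ψ v m := by
    rintro (_ | _ | ⟨i, a⟩) m
    · rfl
    · rfl
    · exact hid i (a + 1) (by lia) m
  let φ : M →ₗ[k] M := ∑ v, ψ v ∘ₗ act T M (eV v)
  have hφ : ∀ m, φ m = ∑ v, ψ v (act T M (eV v) m) := fun m => by simp [φ]
  have hφE : ∀ v m, φ (act T M (eV v) m) = ψ v (act T M (eV v) m) := fun v m => by
    rw [hφ, Finset.sum_eq_single v]
    · rw [act_eV_eV, if_pos rfl]
    · intro w _ hw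
      rw [act_eV_eV, if_neg hw.symm, map_zero]
    · simp
  have hEφ : ∀ v m, act T M (eV v) (φ m) = ψ v (act T M (eV v) m) := fun v m => by
    rw [hφ, map_sum, Finset.sum_eq_single v]
    · exact hψE v m
    · intro w _ hw
      rw [← hψE, act_eV_eV, if_neg hw]
    · simp
  have hcommute : ∀ x m, φ (act T M x m) = act T M x (φ m) := by
    intro x
    induction x using PathAlg.induction with
    | hs c =>
      intro m
      have h : ∀ m, act T M (algebraMap k _ c) m = c • m := fun m => by
        rw [act_apply, mkA_algebraMap]
        exact algebraMap_smul (Alg T)ᵐᵒᵖ c m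
      rw [h, h, map_smul]
    | he v => intro m; rw [hφE, hEφ]
    | ha i j =>
      intro m
      rcases lt_or_ge j (T.ℓ i) with hj | hj
      · rw [← act_arE_eV, hφE, hψδ i (j + 1) hj, act_arE_eV, ← act_eV_arE, hcomm i j hj,
          ← hψδ i j hj.le, ← hEφ, act_eV_arE]
      · simp [act_apply, arE_eq_zero hj]
    | hadd x y hx hy =>
      intro m
      have h : ∀ m, act T M (x + y) m = act T M x m + act T M y m := fun m => by
        simp [act_apply, add_smul]
      rw [h, h, map_add, hx, hy]
    | hmul x y hx hy => intro m; rw [act_mul, act_mul, hy, hx]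
  refine ⟨{ toFun := φ, map_add' := map_add φ, map_smul' := fun r m => ?_ }, ?_, ?_, ?_⟩
  · obtain ⟨x, hx⟩ := mkA_surjective T r.unop
    have h := hcommute x m
    rwa [act_apply, act_apply, hx] at h
  · ext m
    change φ (φ m) = φ m
    rw [hφ m, map_sum]
    refine Finset.sum_congr rfl fun v _ => ?_
    rw [← hψE, hφE, hψE, hψψ]
  · exact fun m => hφE .src m
  · exact fun m => hφE .snk m

end Modules

/-- Let `A = kQ/I` be a non simply connected toupie algebra with
`dim_k e₀ A e∞ = 0`.  If `M` is an indecomposable (finite-dimensional right) `A`-module,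
viewed as a representation of `(Q, I)`, then `M_0 = 0` or `M_∞ = 0`. -/
theorem vanishAt_src_or_snk {k : Type u} [Field k] (T : ToupieAlg k)
    (hnsc : ¬ SimplyConnected T) (hm : mDim T = 0)
    (M : ModuleCat.{u} (Alg T)ᵐᵒᵖ) (hind : Indec (Alg T)ᵐᵒᵖ M) (hfd : FdMod (Alg T)ᵐᵒᵖ M) :
    VanishAt T M Vtx.src ∨ VanishAt T M Vtx.snk := by
  let _ : Module k M := Module.compHom M (algebraMap k (Alg T)ᵐᵒᵖ)
  have : IsScalarTower k (Alg T)ᵐᵒᵖ M :=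
    ⟨fun c r m => by rw [Algebra.smul_def, mul_smul]; rfl⟩
  obtain ⟨φ, hφ, hsrc, hsnk⟩ := exists_idempotent (M := M) hm
  rcases hind.2 φ hφ with rfl | rfl
  · exact Or.inl fun m => (hsrc m).symm
  · exact Or.inr hsnk

end Toupie
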